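/- arXiv:2604.00289 — 2 statements merged into one kernel-verified Lean document; each statement's English description precedes it below -/
import Mathlib

section
/- Let ω ∈ ℂ satisfy ω² + ω + 1 = 0 (i.e., ω is a primitive cube root of unity). The set of points [x:y:z] in the complex projective plane ℙ²(ℂ) satisfying the two homogeneous equations x² + y² + z² = 0 and xy + yz + zx = 0 is exactly the two-element set {[1:ω:ω²], [1:ω²:ω]}. -/
open Projectivization

/-- A point of projective space is the class of `w` iff its representative is a multiple of `w`. -/
theorem Projectivization.eq_mk_iff_exists_smul_eq_rep {K V : Type*} [DivisionRing K]
    [AddCommGroup V] [Module K V] (P : Projectivization K V) (w : V) (hw : w ≠ 0) :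
    P = Projectivization.mk K w hw ↔ ∃ a : K, a • w = P.rep := by
  conv_lhs => rw [← P.mk_rep]
  exact Projectivization.mk_eq_mk_iff' K _ _ P.rep_nonzero hw

/-- A vector lies on both conics iff it is a multiple of `(1, ω, ω²)` or of `(1, ω², ω)`. -/
theorem conics_eq_zero_iff_exists_smul {K : Type*} [Field K] {ω : K}
    (hω : ω ^ 2 + ω + 1 = 0) (v : Fin 3 → K) :
    (v 0 ^ 2 + v 1 ^ 2 + v 2 ^ 2 = 0 ∧ v 0 * v 1 + v 1 * v 2 + v 2 * v 0 = 0) ↔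
      (∃ a : K, a • ![1, ω, ω ^ 2] = v) ∨ ∃ a : K, a • ![1, ω ^ 2, ω] = v := by
  constructor
  · rintro ⟨h₁, h₂⟩
    have hsum : v 0 + v 1 + v 2 = 0 := by
      rw [← sq_eq_zero_iff]
      linear_combination h₁ + 2 * h₂
    have hprod : (v 1 - ω * v 0) * (v 1 - ω ^ 2 * v 0) = 0 := by
      linear_combination (v 0 + v 1) * hsum - h₂ +
        ((ω - 1) * v 0 ^ 2 - v 0 * v 1) * hω
    rcases mul_eq_zero.mp hprod with h | h
    · refine Or.inl ⟨v 0, ?_⟩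
      ext i
      fin_cases i
      · simp
      · simp
        linear_combination -h
      · simp
        linear_combination v 0 * hω - hsum + h
    · refine Or.inr ⟨v 0, ?_⟩
      ext i
      fin_cases i
      · simp
      · simp
        linear_combination -h
      · simp
        linear_combination v 0 * hω - hsum + h
  · rintro (⟨a, rfl⟩ | ⟨a, rfl⟩)
    all_goals
      simp
      constructor
      · linear_combination a ^ 2 * (ω ^ 2 - ω + 1) * hω
      · linear_combination a ^ 2 * ω * hω

/-- Let `ω ∈ ℂ` with `ω² + ω + 1 = 0`.  The set of points `[x:y:z]` of
`ℙ²(ℂ)` satisfying `x² + y² + z² = 0` and `xy + yz + zx = 0` is exactly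
`{[1:ω:ω²], [1:ω²:ω]}`. -/
theorem conic_intersection_C3 (ω : ℂ) (hω : ω ^ 2 + ω + 1 = 0) :
    {P : Projectivization ℂ (Fin 3 → ℂ) |
        (P.rep 0) ^ 2 + (P.rep 1) ^ 2 + (P.rep 2) ^ 2 = 0 ∧
        (P.rep 0) * (P.rep 1) + (P.rep 1) * (P.rep 2) + (P.rep 2) * (P.rep 0) = 0} =
      {Projectivization.mk ℂ ![1, ω, ω ^ 2]
          (by intro h; have := congrFun h 0; simp at this),
        Projectivization.mk ℂ ![1, ω ^ 2, ω]
          (by intro h; have := congrFun h 0; simp at this)} := by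
  ext P
  simp only [Set.mem_ofPred_eq, Set.mem_insert_iff, Set.mem_singleton_iff,
    Projectivization.eq_mk_iff_exists_smul_eq_rep]
  exact conics_eq_zero_iff_exists_smul hω P.rep
end

section
/- The quotient ℂ-algebra ℂ[y,z]/(y² + z² + 1, y + z + yz) is isomorphic as a ℂ-algebra to the product ℂ[s]/(s²) × ℂ[s]/(s²). In particular it is a 4-dimensional ℂ-vector space. -/
open MvPolynomial

/-- An idempotent `e` glues two algebra homomorphisms into one defined on the product. -/
def AlgHom.prodOfIsIdempotentElem {R A B C : Type*} [CommRing R] [CommRing A] [Ring B] [Ring C]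
    [Algebra R A] [Algebra R B] [Algebra R C] (e : A) (he : e * e = e)
    (f : B →ₐ[R] A) (g : C →ₐ[R] A) : B × C →ₐ[R] A :=
  AlgHom.ofLinearMap
    (((LinearMap.mulLeft R e) ∘ₗ f.toLinearMap).coprod
      ((LinearMap.mulLeft R (1 - e)) ∘ₗ g.toLinearMap))
    (by simp)
    (by
      intro x y
      simp only [LinearMap.coprod_apply, LinearMap.comp_apply, LinearMap.mulLeft_apply,
        AlgHom.toLinearMap_apply, Prod.fst_mul, Prod.snd_mul, map_mul]
      linear_combination (-(f x.1 - g x.2) * (f y.1 - g y.2)) * he)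

theorem AlgHom.prodOfIsIdempotentElem_apply {R A B C : Type*} [CommRing R] [CommRing A] [Ring B]
    [Ring C] [Algebra R A] [Algebra R B] [Algebra R C] (e : A) (he : e * e = e)
    (f : B →ₐ[R] A) (g : C →ₐ[R] A) (x : B × C) :
    AlgHom.prodOfIsIdempotentElem e he f g x = e * f x.1 + (1 - e) * g x.2 := rfl

/-- The dual numbers `ℂ[s]/(s²)`. -/
abbrev DualQuotient : Type := Polynomial ℂ ⧸ Ideal.span {(Polynomial.X : Polynomial ℂ) ^ 2}

namespace DualQuotient

/-- The class of `s` in `ℂ[s]/(s²)`. -/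
noncomputable def s : DualQuotient := Ideal.Quotient.mk _ Polynomial.X

theorem s_sq : s ^ 2 = 0 := by
  rw [s, ← map_pow]
  exact Ideal.Quotient.eq_zero_iff_mem.2 (Ideal.subset_span rfl)

/-- The algebra homomorphism out of `ℂ[s]/(s²)` sending `s` to an element of square zero. -/
noncomputable def lift {A : Type*} [CommRing A] [Algebra ℂ A] (n : A) (hn : n ^ 2 = 0) :
    DualQuotient →ₐ[ℂ] A :=
  Ideal.Quotient.liftₐ _ (Polynomial.aeval n) (by
    intro a ha
    obtain ⟨b, rfl⟩ := Ideal.mem_span_singleton.1 ha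
    simp [hn])

theorem lift_s {A : Type*} [CommRing A] [Algebra ℂ A] (n : A) (hn : n ^ 2 = 0) :
    lift n hn s = n :=
  Polynomial.aeval_X n

theorem algHom_ext {A : Type*} [CommRing A] [Algebra ℂ A] {f g : DualQuotient →ₐ[ℂ] A}
    (h : f s = g s) : f = g :=
  Ideal.Quotient.algHom_ext _ (Polynomial.algHom_ext h)

theorem finrank_eq_two : Module.finrank ℂ DualQuotient = 2 := by
  rw [finrank_quotient_span_eq_natDegree, Polynomial.natDegree_X_pow]

instance : Module.Finite ℂ DualQuotient :=
  Module.finite_of_finrank_pos (by rw [finrank_eq_two]; norm_num)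

end DualQuotient

/-- The coordinate ring `ℂ[y,z]/(y² + z² + 1, y + z + yz)`. -/
abbrev ConicIntersection : Type := MvPolynomial (Fin 2) ℂ ⧸
  Ideal.span {(X 0 : MvPolynomial (Fin 2) ℂ) ^ 2 + X 1 ^ 2 + 1, X 0 + X 1 + X 0 * X 1}

namespace ConicIntersection

/-- The class of `y`. -/
noncomputable def y : ConicIntersection := Ideal.Quotient.mk _ (X 0)

/-- The class of `z`. -/
noncomputable def z : ConicIntersection := Ideal.Quotient.mk _ (X 1)

theorem sq_add_sq_add_one : y ^ 2 + z ^ 2 + 1 = 0 :=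
  Ideal.Quotient.eq_zero_iff_mem.2 (Ideal.subset_span (Or.inl rfl))

theorem add_add_mul : y + z + y * z = 0 :=
  Ideal.Quotient.eq_zero_iff_mem.2 (Ideal.subset_span (Or.inr rfl))

/-- The algebra homomorphism determined by a solution of the two equations. -/
noncomputable def lift {A : Type*} [CommRing A] [Algebra ℂ A] (a b : A)
    (h₁ : a ^ 2 + b ^ 2 + 1 = 0) (h₂ : a + b + a * b = 0) : ConicIntersection →ₐ[ℂ] A :=
  Ideal.Quotient.liftₐ _ (aeval ![a, b]) (by
    intro p hp
    refine (Ideal.span_le (I := RingHom.ker (aeval ![a, b] : _ →ₐ[ℂ] A))).2 ?_ hp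
    rintro q (rfl | rfl) <;> simp [RingHom.mem_ker, h₁, h₂])

theorem lift_y {A : Type*} [CommRing A] [Algebra ℂ A] (a b : A)
    (h₁ : a ^ 2 + b ^ 2 + 1 = 0) (h₂ : a + b + a * b = 0) : lift a b h₁ h₂ y = a :=
  aeval_X _ 0

theorem lift_z {A : Type*} [CommRing A] [Algebra ℂ A] (a b : A)
    (h₁ : a ^ 2 + b ^ 2 + 1 = 0) (h₂ : a + b + a * b = 0) : lift a b h₁ h₂ z = b :=
  aeval_X _ 1

theorem algHom_ext {A : Type*} [CommRing A] [Algebra ℂ A] {f g : ConicIntersection →ₐ[ℂ] A}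
    (hy : f y = g y) (hz : f z = g z) : f = g := by
  refine Ideal.Quotient.algHom_ext _ (MvPolynomial.algHom_ext fun i => ?_)
  fin_cases i
  · exact hy
  · exact hz

theorem add_add_one_sq : (y + z + 1) ^ 2 = 0 := by
  linear_combination sq_add_sq_add_one + 2 * add_add_mul

section Points

variable {A : Type*} [CommRing A] {w t n : A}

/-- The `y`-coordinate of the tangent vector at the intersection point `(w, w²)`, for `w` with
`w² + w + 1 = 0`, `t = 1/3` and `n` of square zero. The `z`-coordinate is the
`y`-coordinate at the conjugate root `-1 - w`. -/
def tangentCoord (w t n : A) : A := w + t * (1 - w) * n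

theorem tangentCoord_sq (hw : w ^ 2 + w + 1 = 0) (hn : n ^ 2 = 0) :
    tangentCoord w t n ^ 2 + tangentCoord (-1 - w) t n ^ 2 + 1 = 0 := by
  unfold tangentCoord
  grind

theorem tangentCoord_add (hw : w ^ 2 + w + 1 = 0) (hn : n ^ 2 = 0) :
    tangentCoord w t n + tangentCoord (-1 - w) t n +
      tangentCoord w t n * tangentCoord (-1 - w) t n = 0 := by
  unfold tangentCoord
  grind

/-- The function on the intersection that is `1` near `(w, w²)` and `0` near `(w², w)`. -/
def idem (w t a b : A) : A :=
  -(t * (2 * w + 1)) * (a + t * (a - 1) * (a + b + 1) + 1 + w)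

theorem idem_mul_self (hw : w ^ 2 + w + 1 = 0) (ht : 3 * t = 1) {a b : A}
    (h₁ : a ^ 2 + b ^ 2 + 1 = 0) (h₂ : a + b + a * b = 0) :
    idem w t a b * idem w t a b = idem w t a b := by
  unfold idem
  grind

theorem idem_tangentCoord (hw : w ^ 2 + w + 1 = 0) (ht : 3 * t = 1) (hn : n ^ 2 = 0) :
    idem w t (tangentCoord w t n) (tangentCoord (-1 - w) t n) = 1 := by
  unfold idem tangentCoord
  grind

theorem idem_tangentCoord_conj (hw : w ^ 2 + w + 1 = 0) (ht : 3 * t = 1) (hn : n ^ 2 = 0) :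
    idem w t (tangentCoord (-1 - w) t n) (tangentCoord w t n) = 0 := by
  unfold idem tangentCoord
  grind

theorem idem_mul_tangentCoord_add (hw : w ^ 2 + w + 1 = 0) (ht : 3 * t = 1) {a b : A}
    (h₁ : a ^ 2 + b ^ 2 + 1 = 0) (h₂ : a + b + a * b = 0) :
    idem w t a b * tangentCoord w t (a + b + 1) +
      (1 - idem w t a b) * tangentCoord (-1 - w) t (a + b + 1) = a := by
  unfold idem tangentCoord
  grind

theorem tangentCoord_add_conj (ht : 3 * t = 1) :
    tangentCoord w t n + tangentCoord (-1 - w) t n + 1 = n := by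
  unfold tangentCoord
  linear_combination n * ht

end Points

section Equiv

open DualQuotient (s s_sq)

theorem map_tangentCoord {A B F : Type*} [CommRing A] [CommRing B] [FunLike F A B]
    [RingHomClass F A B] (f : F) (w t n : A) :
    f (tangentCoord w t n) = tangentCoord (f w) (f t) (f n) := by
  simp [tangentCoord]

theorem map_idem {A B F : Type*} [CommRing A] [CommRing B] [FunLike F A B]
    [RingHomClass F A B] (f : F) (w t a b : A) :
    f (idem w t a b) = idem (f w) (f t) (f a) (f b) := by
  simp [idem, two_mul]

theorem algebraMap_root (A : Type*) [CommRing A] [Algebra ℂ A] {ω : ℂ}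
    (hω : ω ^ 2 + ω + 1 = 0) :
    algebraMap ℂ A ω ^ 2 + algebraMap ℂ A ω + 1 = 0 := by
  simpa using congrArg (algebraMap ℂ A) hω

theorem three_mul_algebraMap (A : Type*) [CommRing A] [Algebra ℂ A] :
    3 * algebraMap ℂ A (1 / 3) = 1 := by
  rw [← map_ofNat (algebraMap ℂ A) 3, ← map_mul]
  norm_num

theorem conj_root {A : Type*} [CommRing A] {w : A} (hw : w ^ 2 + w + 1 = 0) :
    (-1 - w) ^ 2 + (-1 - w) + 1 = 0 := by
  linear_combination hw

/-- Restriction of functions to the first-order neighbourhood of the point `(ω, ω²)`. -/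
noncomputable def restrict {ω : ℂ} (hω : ω ^ 2 + ω + 1 = 0) :
    ConicIntersection →ₐ[ℂ] DualQuotient :=
  lift _ _
    (tangentCoord_sq (t := algebraMap ℂ _ (1 / 3)) (algebraMap_root DualQuotient hω) s_sq)
    (tangentCoord_add (algebraMap_root DualQuotient hω) s_sq)

theorem restrict_y {ω : ℂ} (hω : ω ^ 2 + ω + 1 = 0) :
    restrict hω y = tangentCoord (algebraMap ℂ _ ω) (algebraMap ℂ _ (1 / 3)) s :=
  lift_y _ _ _ _

theorem restrict_z {ω : ℂ} (hω : ω ^ 2 + ω + 1 = 0) :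
    restrict hω z = tangentCoord (-1 - algebraMap ℂ _ ω) (algebraMap ℂ _ (1 / 3)) s :=
  lift_z _ _ _ _

theorem restrict_add_add_one {ω : ℂ} (hω : ω ^ 2 + ω + 1 = 0) :
    restrict hω (y + z + 1) = s := by
  rw [map_add, map_add, map_one, restrict_y, restrict_z,
    tangentCoord_add_conj (three_mul_algebraMap _)]

theorem restrict_idem {ω : ℂ} (hω : ω ^ 2 + ω + 1 = 0) :
    restrict hω (idem (algebraMap ℂ _ ω) (algebraMap ℂ _ (1 / 3)) y z) = 1 := by
  rw [map_idem, restrict_y, restrict_z, AlgHom.commutes, AlgHom.commutes]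
  exact idem_tangentCoord (algebraMap_root _ hω) (three_mul_algebraMap _) s_sq

theorem restrict_conj_idem {ω : ℂ} (hω : ω ^ 2 + ω + 1 = 0) :
    restrict (conj_root hω) (idem (algebraMap ℂ _ ω) (algebraMap ℂ _ (1 / 3)) y z) = 0 := by
  rw [map_idem, restrict_y, restrict_z, AlgHom.commutes, AlgHom.commutes]
  have h := idem_tangentCoord_conj (algebraMap_root DualQuotient hω)
    (three_mul_algebraMap _) s_sq
  simpa using h

/-- The inverse of restriction to the two points, glued along the idempotent. -/
noncomputable def glue {ω : ℂ} (hω : ω ^ 2 + ω + 1 = 0) :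
    DualQuotient × DualQuotient →ₐ[ℂ] ConicIntersection :=
  AlgHom.prodOfIsIdempotentElem
    (idem (algebraMap ℂ _ ω) (algebraMap ℂ _ (1 / 3)) y z)
    (idem_mul_self (algebraMap_root _ hω) (three_mul_algebraMap _) sq_add_sq_add_one add_add_mul)
    (DualQuotient.lift _ add_add_one_sq) (DualQuotient.lift _ add_add_one_sq)

theorem restrict_lift {ω : ℂ} (hω : ω ^ 2 + ω + 1 = 0) (x : DualQuotient) :
    restrict hω (DualQuotient.lift _ add_add_one_sq x) = x := by
  have h : (restrict hω).comp (DualQuotient.lift _ add_add_one_sq) = AlgHom.id ℂ _ := by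
    apply DualQuotient.algHom_ext
    rw [AlgHom.comp_apply, DualQuotient.lift_s, restrict_add_add_one, AlgHom.id_apply]
  exact DFunLike.congr_fun h x

theorem restrict_glue {ω : ℂ} (hω : ω ^ 2 + ω + 1 = 0) :
    ((restrict hω).prod (restrict (conj_root hω))).comp (glue hω) = AlgHom.id ℂ _ := by
  apply AlgHom.ext
  intro x
  apply Prod.ext <;>
    simp [glue, AlgHom.prodOfIsIdempotentElem_apply, -one_div, restrict_idem,
      restrict_conj_idem hω, restrict_lift]

theorem glue_restrict {ω : ℂ} (hω : ω ^ 2 + ω + 1 = 0) :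
    (glue hω).comp ((restrict hω).prod (restrict (conj_root hω))) = AlgHom.id ℂ _ := by
  have h := idem_mul_tangentCoord_add (algebraMap_root ConicIntersection hω)
    (three_mul_algebraMap _) sq_add_sq_add_one add_add_mul
  have h' := tangentCoord_add_conj (w := algebraMap ℂ ConicIntersection ω) (n := y + z + 1)
    (three_mul_algebraMap _)
  apply algHom_ext
  · simpa [glue, AlgHom.prodOfIsIdempotentElem_apply, -one_div, restrict_y, map_tangentCoord,
      DualQuotient.lift_s, AlgHom.commutes] using h
  · simp only [glue, AlgHom.comp_apply, AlgHom.prod_apply, AlgHom.prodOfIsIdempotentElem_apply,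
      restrict_z, map_tangentCoord, map_sub, map_neg, map_one, DualQuotient.lift_s,
      AlgHom.commutes, AlgHom.id_apply, sub_sub_cancel]
    linear_combination h' - h

/-- The intersection of the two conics is the disjoint union of two double points. -/
noncomputable def equivProd {ω : ℂ} (hω : ω ^ 2 + ω + 1 = 0) :
    ConicIntersection ≃ₐ[ℂ] DualQuotient × DualQuotient :=
  AlgEquiv.ofAlgHom _ _ (restrict_glue hω) (glue_restrict hω)

end Equiv

end ConicIntersection

theorem Complex.exists_sq_add_self_add_one_eq_zero : ∃ ω : ℂ, ω ^ 2 + ω + 1 = 0 := by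
  obtain ⟨r, hr⟩ := IsAlgClosed.exists_pow_nat_eq (-3 : ℂ) two_pos
  exact ⟨(r - 1) / 2, by linear_combination hr / 4⟩

/-- The quotient `ℂ`-algebra `ℂ[y,z]/(y² + z² + 1, y + z + yz)` is
isomorphic as a `ℂ`-algebra to `ℂ[s]/(s²) × ℂ[s]/(s²)`; in particular it is a
`4`-dimensional `ℂ`-vector space. -/
theorem coordinate_ring_of_nontransverse_intersection :
    Nonempty
      ((MvPolynomial (Fin 2) ℂ ⧸
          Ideal.span {(X 0 : MvPolynomial (Fin 2) ℂ) ^ 2 + X 1 ^ 2 + 1,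
            X 0 + X 1 + X 0 * X 1})
        ≃ₐ[ℂ]
          ((Polynomial ℂ ⧸ Ideal.span {(Polynomial.X : Polynomial ℂ) ^ 2}) ×
            (Polynomial ℂ ⧸ Ideal.span {(Polynomial.X : Polynomial ℂ) ^ 2}))) ∧
    Module.finrank ℂ
      (MvPolynomial (Fin 2) ℂ ⧸
        Ideal.span {(X 0 : MvPolynomial (Fin 2) ℂ) ^ 2 + X 1 ^ 2 + 1,
          X 0 + X 1 + X 0 * X 1}) = 4 := by
  obtain ⟨ω, hω⟩ := Complex.exists_sq_add_self_add_one_eq_zero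
  refine ⟨⟨ConicIntersection.equivProd hω⟩, ?_⟩
  rw [(ConicIntersection.equivProd hω).toLinearEquiv.finrank_eq, Module.finrank_prod,
    DualQuotient.finrank_eq_two]
end
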